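/- Every context-free language L ⊆ Σ* can be written as L = h(Dyck_N ∩ R), where N is a natural number, Dyck_N is the language of balanced parentheses of N types over the alphabet {(₁, )₁, …, (_N, )_N}, R is a regular language over that alphabet, and h : {(₁, )₁, …, (_N, )_N}* → Σ* is a monoid homomorphism of free monoids (a language homomorphism). -/

import Mathlib

/-- The Dyck language of balanced parentheses of `N` types, over the alphabet
`Fin N × Bool`, where `(i, false)` is the opening parenthesis `(ᵢ` and `(i, true)` is the
closing parenthesis `)ᵢ`. It is generated by: the empty word is balanced, a concatenation
of balanced words is balanced, and wrapping a balanced word in a matching pair of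
parentheses of any type yields a balanced word. -/
inductive IsDyck {N : ℕ} : List (Fin N × Bool) → Prop
  | nil : IsDyck []
  | append {u v : List (Fin N × Bool)} : IsDyck u → IsDyck v → IsDyck (u ++ v)
  | wrap (i : Fin N) {u : List (Fin N × Bool)} :
      IsDyck u → IsDyck ((i, false) :: u ++ [(i, true)])

/-- Induction principle for balanced words following their unique decomposition: a nonempty
balanced word is a wrapped balanced word followed by a balanced word. -/
@[elab_as_elim]
theorem IsDyck.induction_wrap_append {N : ℕ} {P : List (Fin N × Bool) → Prop} (nil : P [])
    (wrap_append : ∀ (i : Fin N) (u v : List (Fin N × Bool)), P u → P v →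
      P ((i, false) :: (u ++ (i, true) :: v)))
    {w : List (Fin N × Bool)} (hw : IsDyck w) : P w := by
  have extend : ∀ v, P v → P (w ++ v) := by
    induction hw with
    | nil => exact fun v hv => hv
    | append _ _ ihu ihv =>
      intro z hz
      rw [List.append_assoc]
      exact ihu _ (ihv _ hz)
    | wrap i _ ih =>
      intro z hz
      have hu := ih [] nil
      rw [List.append_nil] at hu
      simpa using wrap_append i _ z hu hz
  simpa using extend [] nil

namespace ContextFreeGrammar

variable {T : Type} (g : ContextFreeGrammar T)

/-- `g.Yields l x` means that the sentential form `l` has a parse forest with terminal word `x`. -/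
inductive Yields : List (Symbol T g.NT) → List T → Prop
  | nil : Yields [] []
  | terminal (t : T) {l : List (Symbol T g.NT)} {x : List T} :
      Yields l x → Yields (.terminal t :: l) (t :: x)
  | nonterminal {r : ContextFreeRule T g.NT} (hr : r ∈ g.rules) {l : List (Symbol T g.NT)}
      {x y : List T} :
      Yields r.output x → Yields l y → Yields (.nonterminal r.input :: l) (x ++ y)

variable {g}

theorem yields_map_terminal (x : List T) : g.Yields (x.map Symbol.terminal) x := by
  induction x with
  | nil => exact .nil
  | cons t x ih => exact .terminal t ih

theorem Yields.exists_of_append {l m : List (Symbol T g.NT)} {x : List T}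
    (h : g.Yields (l ++ m) x) : ∃ y z, g.Yields l y ∧ g.Yields m z ∧ x = y ++ z := by
  induction l generalizing x with
  | nil => exact ⟨[], x, .nil, h, rfl⟩
  | cons X l ih =>
    cases h with
    | terminal t h =>
      obtain ⟨y, z, hy, hz, rfl⟩ := ih h
      exact ⟨t :: y, z, .terminal t hy, hz, rfl⟩
    | nonterminal hr h₁ h₂ =>
      obtain ⟨y, z, hy, hz, rfl⟩ := ih h₂
      exact ⟨_, z, .nonterminal hr h₁ hy, hz, by simp⟩

theorem Yields.of_rewrites {r : ContextFreeRule T g.NT} (hr : r ∈ g.rules)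
    {l m : List (Symbol T g.NT)} (hlm : r.Rewrites l m) {x : List T} (h : g.Yields m x) :
    g.Yields l x := by
  induction hlm generalizing x with
  | head s =>
    obtain ⟨y, z, hy, hz, rfl⟩ := h.exists_of_append
    exact .nonterminal hr hy hz
  | cons X _ ih =>
    cases h with
    | terminal t h => exact .terminal t (ih h)
    | nonterminal hr' h₁ h₂ => exact .nonterminal hr' h₁ (ih h₂)

theorem Derives.yields {l : List (Symbol T g.NT)} {x : List T}
    (h : g.Derives l (x.map Symbol.terminal)) : g.Yields l x := by
  induction h using Relation.ReflTransGen.head_induction_on with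
  | refl => exact yields_map_terminal x
  | head h _ ih =>
    obtain ⟨r, hr, hrw⟩ := h
    exact ih.of_rewrites hr hrw

variable (g)

/-- `g.Expands l m` means that `m` is a sentential form from which the children of the first symbol
of `l` can arise: the right-hand side of a rule if that symbol is a nonterminal, and the empty
form if it is a terminal. -/
inductive Expands : List (Symbol T g.NT) → List (Symbol T g.NT) → Prop
  | terminal (t : T) (l : List (Symbol T g.NT)) : Expands (.terminal t :: l) []
  | nonterminal {r : ContextFreeRule T g.NT} (hr : r ∈ g.rules) (l : List (Symbol T g.NT)) :
      Expands (.nonterminal r.input :: l) r.output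

variable {g} {N : ℕ} (f : Fin N → List (Symbol T g.NT))

/-- The automaton recognizing bracketed parse forests, for brackets labelled through `f` by
sentential forms. A state is the sentential form still to be parsed at the current nesting depth.
The opening bracket `l` starts the subtree of the first symbol of `l`, and the matching closing
bracket returns to the tail of `l`. -/
def bracketNFA (start : Fin N) : NFA (Fin N × Bool) (Fin N) where
  step k a :=
    match a with
    | (i, false) => {k' | i = k ∧ g.Expands (f k) (f k')}
    | (i, true) => {k' | f k = [] ∧ f k' = (f i).tail}
  start := {start}
  accept := {k | f k = []}

/-- The terminal word read off a bracket: an opening bracket labelled by a form starting with a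
terminal contributes that terminal, and all other brackets are erased. -/
def bracketWord (a : Fin N × Bool) : List T :=
  match a.2, f a.1 with
  | false, .terminal t :: _ => [t]
  | _, _ => []

variable {f} {k₀ : Fin N}

theorem mem_bracketNFA_evalFrom_wrap {i k k' : Fin N} {u v : List (Fin N × Bool)} :
    k' ∈ (bracketNFA f k₀).evalFrom {k} ((i, false) :: (u ++ (i, true) :: v)) ↔
      i = k ∧ ∃ c, g.Expands (f k) (f c) ∧ ∃ d, d ∈ (bracketNFA f k₀).evalFrom {c} u ∧
        f d = [] ∧ ∃ e, f e = (f i).tail ∧ k' ∈ (bracketNFA f k₀).evalFrom {e} v := by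
  rw [NFA.evalFrom_cons, NFA.stepSet_singleton, NFA.mem_evalFrom_iff_exists]
  simp only [NFA.evalFrom_append, NFA.evalFrom_cons]
  constructor
  · rintro ⟨c, ⟨hik, hc⟩, hk'⟩
    obtain ⟨e, he, hk'⟩ := NFA.mem_evalFrom_iff_exists.1 hk'
    obtain ⟨d, hd, hde, hei⟩ := NFA.mem_stepSet.1 he
    exact ⟨hik, c, hc, d, hd, hde, e, hei, hk'⟩
  · rintro ⟨hik, c, hc, d, hd, hde, e, hei, hk'⟩
    exact ⟨c, ⟨hik, hc⟩, NFA.mem_evalFrom_iff_exists.2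
      ⟨e, NFA.mem_stepSet.2 ⟨d, hd, hde, hei⟩, hk'⟩⟩

theorem derives_of_mem_bracketNFA_evalFrom {w : List (Fin N × Bool)} (hw : IsDyck w) :
    ∀ k k' : Fin N, k' ∈ (bracketNFA f k₀).evalFrom {k} w → f k' = [] →
      g.Derives (f k) ((w.flatMap (bracketWord f)).map Symbol.terminal) := by
  refine hw.induction_wrap_append ?_ ?_
  · intro k k' hk hk'
    obtain rfl : k' = k := by simpa using hk
    simpa [hk'] using Derives.refl []
  · intro i u v ihu ihv k k' hk hk'
    obtain ⟨rfl, c, hc, d, hd, hdn, e, he, hk⟩ := mem_bracketNFA_evalFrom_wrap.1 hk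
    have hu := ihu _ _ hd hdn
    have hv := ihv _ _ hk hk'
    rw [he] at hv
    have close_word : bracketWord f (i, true) = [] := by simp [bracketWord]
    simp only [List.flatMap_cons, List.flatMap_append, close_word, List.nil_append,
      List.map_append]
    generalize hl : f i = l at *
    generalize f c = m at *
    cases hc with
    | terminal t l =>
      have open_word : bracketWord f (i, false) = [t] := by simp [bracketWord, hl]
      rw [open_word]
      exact ((hv.append_left _).trans (hu.append_right _)).append_left [.terminal t]
    | @nonterminal r hr l =>
      have open_word : bracketWord f (i, false) = [] := by simp [bracketWord, hl]
      rw [open_word]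
      have first : g.Derives (.nonterminal r.input :: l) (r.output ++ l) :=
        Produces.single ⟨r, hr, .head l⟩
      exact first.trans ((hv.append_left _).trans (hu.append_right _))

theorem Yields.exists_isDyck
    (tail_mem : ∀ k, (f k).tail ∈ Set.range f)
    (output_mem : ∀ r ∈ g.rules, r.output ∈ Set.range f)
    (nil_mem : [] ∈ Set.range f)
    {l : List (Symbol T g.NT)} {x : List T} (h : g.Yields l x) :
    ∀ {k : Fin N}, f k = l → ∃ w, IsDyck w ∧ w.flatMap (bracketWord f) = x ∧
      ∃ k', f k' = [] ∧ k' ∈ (bracketNFA f k₀).evalFrom {k} w := by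
  induction h with
  | nil =>
    intro k hk
    exact ⟨[], .nil, rfl, k, hk, by simp⟩
  | @terminal t l x _ ih =>
    intro k hk
    obtain ⟨e, he⟩ := tail_mem k
    obtain ⟨c, hc⟩ := nil_mem
    obtain ⟨v, hv, hvx, k', hk', hkv⟩ := ih (k := e) (by rw [he, hk]; rfl)
    refine ⟨(k, false) :: ([] ++ (k, true) :: v), ?_, ?_, k', hk', ?_⟩
    · simpa using (IsDyck.wrap k .nil).append hv
    · simp [bracketWord, hk, ← hvx]
    · exact mem_bracketNFA_evalFrom_wrap.2
        ⟨rfl, c, by rw [hk, hc]; exact .terminal t l, c, by simp, hc, e, he, hkv⟩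
  | @nonterminal r hr l x y _ _ ihx ihy =>
    intro k hk
    obtain ⟨e, he⟩ := tail_mem k
    obtain ⟨c, hc⟩ := output_mem r hr
    obtain ⟨u, hu, hux, d, hd, hdu⟩ := ihx hc
    obtain ⟨v, hv, hvx, k', hk', hkv⟩ := ihy (k := e) (by rw [he, hk]; rfl)
    refine ⟨(k, false) :: (u ++ (k, true) :: v), ?_, ?_, k', hk', ?_⟩
    · simpa using (IsDyck.wrap k hu).append hv
    · simp [bracketWord, hk, ← hvx, ← hux]
    · exact mem_bracketNFA_evalFrom_wrap.2
        ⟨rfl, c, by rw [hk, hc]; exact .nonterminal hr l, d, hdu, hd, e, he, hkv⟩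

variable (g)

theorem finite_setOf_suffix :
    {l | l <:+ [Symbol.nonterminal g.initial] ∨ ∃ r ∈ g.rules, l <:+ r.output}.Finite := by
  have finite_suffixes (m : List (Symbol T g.NT)) : {l | l <:+ m}.Finite := by
    simpa only [List.mem_tails] using m.tails.finite_toSet
  refine (finite_suffixes _).union
    ((g.rules.finite_toSet.biUnion fun r _ => finite_suffixes r.output).subset ?_)
  rintro l ⟨r, hr, hl⟩
  exact Set.mem_biUnion hr hl

/-- Finitely many labels suffice to name every suffix of a sentential form that occurs in `g`. -/
theorem exists_suffix_labelling :
    ∃ (N : ℕ) (f : Fin N → List (Symbol T g.NT)),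
      [Symbol.nonterminal g.initial] ∈ Set.range f ∧ [] ∈ Set.range f ∧
      (∀ k, (f k).tail ∈ Set.range f) ∧ ∀ r ∈ g.rules, r.output ∈ Set.range f := by
  have := g.finite_setOf_suffix.to_subtype
  obtain ⟨N, ⟨e⟩⟩ := Finite.exists_equiv_fin
    {l | l <:+ [Symbol.nonterminal g.initial] ∨ ∃ r ∈ g.rules, l <:+ r.output}
  refine ⟨N, fun k => (e.symm k).1, ?_⟩
  have range_eq : (Set.range fun k => (e.symm k).1) =
      {l | l <:+ [Symbol.nonterminal g.initial] ∨ ∃ r ∈ g.rules, l <:+ r.output} := by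
    exact (e.symm.surjective.range_comp Subtype.val).trans Subtype.range_val
  rw [range_eq]
  refine ⟨.inl List.suffix_rfl, .inl List.nil_suffix, fun k => ?_,
    fun r hr => .inr ⟨r, hr, List.suffix_rfl⟩⟩
  exact (e.symm k).2.imp (List.tail_suffix _).trans
    fun ⟨r, hr, hl⟩ => ⟨r, hr, (List.tail_suffix _).trans hl⟩

end ContextFreeGrammar

theorem FreeMonoid.toList_lift_ofList {α β : Type*} (φ : α → List β) (w : List α) :
    (FreeMonoid.lift (fun a => FreeMonoid.ofList (φ a)) (FreeMonoid.ofList w)).toList =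
      w.flatMap φ := by
  simp [List.flatMap_def, Function.comp_def]

/-- **Chomsky–Schützenberger representation theorem**: every context-free language `L`
can be written as `L = h(Dyck_N ∩ R)` for some `N`, some regular language `R` over the
alphabet of `N` types of parentheses, and some monoid homomorphism of free monoids `h`. -/
theorem chomsky_schutzenberger {T : Type} (L : Language T) (hL : L.IsContextFree) :
    ∃ (N : ℕ) (R : Language (Fin N × Bool)) (h : FreeMonoid (Fin N × Bool) →* FreeMonoid T),
      R.IsRegular ∧
        L = {x : List T | ∃ w : List (Fin N × Bool),
              IsDyck w ∧ w ∈ R ∧ (h (FreeMonoid.ofList w)).toList = x} := by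
  obtain ⟨g, rfl⟩ := hL
  obtain ⟨N, f, ⟨k₀, hk₀⟩, nil_mem, tail_mem, output_mem⟩ := g.exists_suffix_labelling
  refine ⟨N, (ContextFreeGrammar.bracketNFA f k₀).accepts,
    FreeMonoid.lift fun a => FreeMonoid.ofList (ContextFreeGrammar.bracketWord f a), ?_, ?_⟩
  · exact Language.isRegular_iff.2 ⟨_, inferInstance, _, NFA.toDFA_correct⟩
  · ext x
    simp only [FreeMonoid.toList_lift_ofList]
    constructor
    · intro hx
      obtain ⟨w, hw, hwx, k, hk, hkw⟩ :=
        (ContextFreeGrammar.Derives.yields hx).exists_isDyck tail_mem output_mem nil_mem hk₀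
      exact ⟨w, hw, NFA.mem_accepts.2 ⟨k, hk, hkw⟩, hwx⟩
    · rintro ⟨w, hw, hwR, rfl⟩
      obtain ⟨k, hk, hkw⟩ := NFA.mem_accepts.1 hwR
      have derives := ContextFreeGrammar.derives_of_mem_bracketNFA_evalFrom hw _ _ hkw hk
      rwa [hk₀] at derives
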